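/- Let Ω ⊂⊂ ℂⁿ be a pseudoconvex domain with smooth boundary and ρ a defining function of Ω. Let U_α be an open chart of a tubular neighborhood U of ∂Ω, and let L be a non-vanishing smooth (1,0) tangent vector field on U_α with Lρ = 0, normalized so that ‖L‖² = 1/2. Fix η₂ ∈ (1,∞), write N := N_ρ, and set Σ_L^α := {p ∈ ∂Ω ∩ U_α : L_ρ(L,L)(p) = 0}. If (1/(η₂−1))·|L_ρ(L,N)|²/‖∇ρ‖² − (1/2)·(N L_ρ(L,L))/‖∇ρ‖ < 0 at every point of Σ_L^α, then there exists a neighborhood V_L^α of Σ_L^α in U_α such that L_{ρ^{η₂}}(aL + bN, aL + bN) > 0 for all (a,b) ∈ ℂ² ∖ {(0,0)} at every point of (ℂⁿ ∖ cl(Ω)) ∩ V_L^α. -/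

import Mathlib

noncomputable section

open Complex Topology
open scoped ENNReal

/-- Wirtinger derivative `∂f/∂z_j`. -/
def dz {n : ℕ} (j : Fin n) (f : (Fin n → ℂ) → ℂ) (z : Fin n → ℂ) : ℂ :=
  (fderiv ℝ f z (Pi.single j 1) - Complex.I * fderiv ℝ f z (Pi.single j Complex.I)) / 2

/-- Wirtinger derivative `∂f/∂z̄_j`. -/
def dzbar {n : ℕ} (j : Fin n) (f : (Fin n → ℂ) → ℂ) (z : Fin n → ℂ) : ℂ :=
  (fderiv ℝ f z (Pi.single j 1) + Complex.I * fderiv ℝ f z (Pi.single j Complex.I)) / 2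

/-- Complexification of a real-valued function. -/
def cplx {n : ℕ} (ρ : (Fin n → ℂ) → ℝ) : (Fin n → ℂ) → ℂ := fun z => (ρ z : ℂ)

/-- The Levi form `L_ρ(X,Y)(z) = Σ_{j,k} ∂²ρ/∂z_j∂z̄_k (z) X_j conj(Y_k)`. -/
def levi {n : ℕ} (ρ : (Fin n → ℂ) → ℝ) (X Y : Fin n → ℂ) (z : Fin n → ℂ) : ℂ :=
  ∑ j, ∑ k, dz j (fun w => dzbar k (cplx ρ) w) z * X j * (starRingEnd ℂ) (Y k)

/-- `Xf = Σ_j X_j ∂f/∂z_j` for a (1,0) vector `X`. -/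
def dirDeriv {n : ℕ} (X : Fin n → ℂ) (f : (Fin n → ℂ) → ℂ) (z : Fin n → ℂ) : ℂ :=
  ∑ j, X j * dz j f z

/-- `X̄f = Σ_j conj(X_j) ∂f/∂z̄_j`. -/
def dirDerivBar {n : ℕ} (X : Fin n → ℂ) (f : (Fin n → ℂ) → ℂ) (z : Fin n → ℂ) : ℂ :=
  ∑ j, (starRingEnd ℂ) (X j) * dzbar j f z

/-- Derivative of `f` along the (1,0) vector field `X`. -/
def fieldDeriv {n : ℕ} (X : (Fin n → ℂ) → (Fin n → ℂ)) (f : (Fin n → ℂ) → ℂ)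
    (z : Fin n → ℂ) : ℂ :=
  dirDeriv (X z) f z

/-- Euclidean norm of the real gradient of `ρ`. -/
def gradNorm {n : ℕ} (ρ : (Fin n → ℂ) → ℝ) (z : Fin n → ℂ) : ℝ :=
  Real.sqrt (∑ j, ((fderiv ℝ ρ z (Pi.single j 1)) ^ 2 +
    (fderiv ℝ ρ z (Pi.single j Complex.I)) ^ 2))

/-- The complex normal field `N_ρ`. -/
def nfield {n : ℕ} (ρ : (Fin n → ℂ) → ℝ) (z : Fin n → ℂ) : Fin n → ℂ := fun j =>
  ((Real.sqrt (∑ k, Complex.normSq (dz k (cplx ρ) z)) : ℝ) : ℂ)⁻¹ * dzbar j (cplx ρ) z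

/-- Squared Euclidean norm of a vector in ℂⁿ. -/
def enormSq {n : ℕ} (X : Fin n → ℂ) : ℝ := ∑ j, Complex.normSq (X j)

/-- `f` is strictly plurisubharmonic on `S`. -/
def StrictPSHOn {n : ℕ} (f : (Fin n → ℂ) → ℝ) (S : Set (Fin n → ℂ)) : Prop :=
  ∀ z ∈ S, ∀ X : Fin n → ℂ, X ≠ 0 → 0 < (levi f X X z).re

/-- `ρ` is a (global smooth) defining function of `Ω` on the neighborhood `V` of `cl Ω`. -/
structure IsDefFn {n : ℕ} (Ω V : Set (Fin n → ℂ)) (ρ : (Fin n → ℂ) → ℝ) : Prop where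
  isOpen : IsOpen V
  subset : closure Ω ⊆ V
  smooth : ContDiffOn ℝ (⊤ : ℕ∞) ρ V
  eq : Ω = {z ∈ V | ρ z < 0}
  grad_ne : ∀ z ∈ frontier Ω, fderiv ℝ ρ z ≠ 0

/-- The Levi form of `ρ` is positive semidefinite on complex tangent vectors at `z`. -/
def LeviPseudoconvexAt {n : ℕ} (ρ : (Fin n → ℂ) → ℝ) (z : Fin n → ℂ) : Prop :=
  ∀ X : Fin n → ℂ, dirDeriv X (cplx ρ) z = 0 → 0 ≤ (levi ρ X X z).re

/-- `Ω` is a (smoothly bounded, Levi) pseudoconvex domain. -/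
def IsPseudoconvex {n : ℕ} (Ω : Set (Fin n → ℂ)) : Prop :=
  ∃ (V : Set (Fin n → ℂ)) (ρ : (Fin n → ℂ) → ℝ), IsDefFn Ω V ρ ∧
    ∀ p ∈ frontier Ω, LeviPseudoconvexAt ρ p

/-- The set of Steinness exponents of `ρ`. -/
def steinExpSet {n : ℕ} (Ω : Set (Fin n → ℂ)) (ρ : (Fin n → ℂ) → ℝ) : Set ℝ :=
  {η : ℝ | 1 < η ∧ ∃ W : Set (Fin n → ℂ), IsOpen W ∧ frontier Ω ⊆ W ∧
    StrictPSHOn (fun z => ρ z ^ η) ((closure Ω)ᶜ ∩ W)}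

/-- The Steinness exponent `η̃_ρ` of a defining function `ρ` (`∞` if none exists). -/
def steinExp {n : ℕ} (Ω : Set (Fin n → ℂ)) (ρ : (Fin n → ℂ) → ℝ) : ℝ≥0∞ :=
  sInf (ENNReal.ofReal '' steinExpSet Ω ρ)

/-- The Steinness index `S(Ω)`. -/
def steinIndex {n : ℕ} (Ω : Set (Fin n → ℂ)) : ℝ≥0∞ :=
  ⨅ (V : Set (Fin n → ℂ)) (ρ : (Fin n → ℂ) → ℝ) (_ : IsDefFn Ω V ρ), steinExp Ω ρ

/-- The set of Diederich–Fornæss exponents of `ρ`. -/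
def dfExpSet {n : ℕ} (Ω : Set (Fin n → ℂ)) (ρ : (Fin n → ℂ) → ℝ) : Set ℝ :=
  {η : ℝ | 0 < η ∧ η < 1 ∧ StrictPSHOn (fun z => -((-ρ z) ^ η)) Ω}

/-- The Diederich–Fornæss exponent of `ρ` (`0` if no exponent exists). -/
def dfExp {n : ℕ} (Ω : Set (Fin n → ℂ)) (ρ : (Fin n → ℂ) → ℝ) : ℝ :=
  sSup (insert 0 (dfExpSet Ω ρ))

/-- The Diederich–Fornæss index `DF(Ω)`. -/
def dfIndex {n : ℕ} (Ω : Set (Fin n → ℂ)) : ℝ :=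
  sSup {t : ℝ | ∃ V ρ, IsDefFn Ω V ρ ∧ t = dfExp Ω ρ}

/-- `L` is a smooth (1,0) tangent vector field for `ρ` on `A`. -/
def IsTangentField {n : ℕ} (ρ : (Fin n → ℂ) → ℝ) (L : (Fin n → ℂ) → (Fin n → ℂ))
    (A : Set (Fin n → ℂ)) : Prop :=
  ContDiffOn ℝ (⊤ : ℕ∞) L A ∧ ∀ z ∈ A, dirDeriv (L z) (cplx ρ) z = 0

/-- The key differential inequality
`(1/(η₂−1))|L_ρ(L,N)|²/‖∇ρ‖² − (1/2)(N L_ρ(L,L))/‖∇ρ‖ ≤ 0` at `p`. -/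
def keyIneqAt {n : ℕ} (ρ : (Fin n → ℂ) → ℝ) (L : (Fin n → ℂ) → (Fin n → ℂ)) (η₂ : ℝ)
    (p : Fin n → ℂ) : Prop :=
  1 / (η₂ - 1) * Complex.normSq (levi ρ (L p) (nfield ρ p) p) / (gradNorm ρ p) ^ 2 -
    1 / 2 * (fieldDeriv (nfield ρ) (fun w => levi ρ (L w) (L w) w) p).re / gradNorm ρ p ≤ 0

/-- The strict version of the key differential inequality. -/
def strictKeyIneqAt {n : ℕ} (ρ : (Fin n → ℂ) → ℝ) (L : (Fin n → ℂ) → (Fin n → ℂ)) (η₂ : ℝ)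
    (p : Fin n → ℂ) : Prop :=
  1 / (η₂ - 1) * Complex.normSq (levi ρ (L p) (nfield ρ p) p) / (gradNorm ρ p) ^ 2 -
    1 / 2 * (fieldDeriv (nfield ρ) (fun w => levi ρ (L w) (L w) w) p).re / gradNorm ρ p < 0

/-- `cl Ω` has a strong Stein neighborhood basis. -/
def HasStrongSteinBasis {n : ℕ} (Ω : Set (Fin n → ℂ)) : Prop :=
  ∃ (V : Set (Fin n → ℂ)) (ρ : (Fin n → ℂ) → ℝ), IsDefFn Ω V ρ ∧ ∃ ε₀ : ℝ, 0 < ε₀ ∧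
    (∀ z ∈ V, 0 ≤ ρ z → ρ z < ε₀ → fderiv ℝ ρ z ≠ 0) ∧
    ∀ ε : ℝ, 0 ≤ ε → ε < ε₀ → ∀ z ∈ V, ρ z = ε → LeviPseudoconvexAt ρ z

/-- Vanishing order at `0` of a holomorphic function `ℂ → ℂ` (`∞` if all derivatives vanish). -/
def orderC (h : ℂ → ℂ) : ℕ∞ :=
  sInf ((fun k : ℕ => (k : ℕ∞)) '' {k : ℕ | iteratedDeriv k h 0 ≠ 0})

/-- Vanishing order at `0` of a real-valued function on `ℂ`. -/
def orderR (g : ℂ → ℝ) : ℕ∞ :=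
  sInf ((fun k : ℕ => (k : ℕ∞)) '' {k : ℕ | iteratedFDeriv ℝ k g 0 ≠ 0})

/-- `ν(γ)`: minimal vanishing order at `0` of the components of `γ − p`. -/
def curveOrder {n : ℕ} (γ : ℂ → Fin n → ℂ) (p : Fin n → ℂ) : ℕ∞ :=
  ⨅ j, orderC (fun t => γ t j - p j)

/-- `p` is a boundary point of finite D'Angelo 1-type (w.r.t. the defining function `ρ`). -/
def FiniteTypePt {n : ℕ} (ρ : (Fin n → ℂ) → ℝ) (p : Fin n → ℂ) : Prop :=
  ∃ M : ℕ, ∀ γ : ℂ → Fin n → ℂ, (∀ j, AnalyticAt ℂ (fun t => γ t j) 0) → γ 0 = p →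
    ¬ (∀ᶠ t in nhds (0 : ℂ), γ t = p) →
    orderR (fun t => ρ (γ t)) ≤ (M : ℕ∞) * curveOrder γ p

theorem fderiv_cplx {n : ℕ} {ρ : (Fin n → ℂ) → ℝ} {z : Fin n → ℂ}
    (h : DifferentiableAt ℝ ρ z) (v : Fin n → ℂ) :
    fderiv ℝ (cplx ρ) z v = ((fderiv ℝ ρ z v : ℝ) : ℂ) := by
  have := (Complex.ofRealCLM.hasFDerivAt.comp z h.hasFDerivAt).fderiv
  have h2 : cplx ρ = Complex.ofRealCLM ∘ ρ := rfl
  rw [h2, this]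
  rfl

theorem contDiffAt_cplx {n : ℕ} {ρ : (Fin n → ℂ) → ℝ} {z : Fin n → ℂ} {m : WithTop ℕ∞}
    (h : ContDiffAt ℝ m ρ z) : ContDiffAt ℝ m (cplx ρ) z :=
  Complex.ofRealCLM.contDiff.contDiffAt.comp z h

theorem contDiffAt_fderiv_apply {n : ℕ} {f : (Fin n → ℂ) → ℂ} {z : Fin n → ℂ}
    (h : ContDiffAt ℝ (⊤ : ℕ∞) f z) (v : Fin n → ℂ) :
    ContDiffAt ℝ (⊤ : ℕ∞) (fun w => fderiv ℝ f w v) z :=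
  (h.fderiv_right (m := (⊤ : ℕ∞)) (by simp)).clm_apply contDiffAt_const

theorem contDiffAt_dz {n : ℕ} {f : (Fin n → ℂ) → ℂ} {z : Fin n → ℂ}
    (h : ContDiffAt ℝ (⊤ : ℕ∞) f z) (j : Fin n) :
    ContDiffAt ℝ (⊤ : ℕ∞) (dz j f) z :=
  ((contDiffAt_fderiv_apply h _).sub
    (contDiffAt_const.mul (contDiffAt_fderiv_apply h _))).div_const 2

theorem contDiffAt_dzbar {n : ℕ} {f : (Fin n → ℂ) → ℂ} {z : Fin n → ℂ}
    (h : ContDiffAt ℝ (⊤ : ℕ∞) f z) (j : Fin n) :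
    ContDiffAt ℝ (⊤ : ℕ∞) (dzbar j f) z :=
  ((contDiffAt_fderiv_apply h _).add
    (contDiffAt_const.mul (contDiffAt_fderiv_apply h _))).div_const 2

theorem dz_congr {n : ℕ} {f g : (Fin n → ℂ) → ℂ} {z : Fin n → ℂ} (h : f =ᶠ[𝓝 z] g)
    (j : Fin n) : dz j f z = dz j g z := by
  simp only [dz, h.fderiv_eq]

theorem dz_mul {n : ℕ} {f g : (Fin n → ℂ) → ℂ} {z : Fin n → ℂ}
    (hf : DifferentiableAt ℝ f z) (hg : DifferentiableAt ℝ g z) (j : Fin n) :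
    dz j (fun w => f w * g w) z = f z * dz j g z + g z * dz j f z := by
  simp only [dz, fderiv_fun_mul hf hg, add_apply,
    smul_apply, smul_eq_mul]
  ring

theorem dzbar_cplx {n : ℕ} {ρ : (Fin n → ℂ) → ℝ} {z : Fin n → ℂ}
    (h : DifferentiableAt ℝ ρ z) (j : Fin n) :
    dzbar j (cplx ρ) z = (starRingEnd ℂ) (dz j (cplx ρ) z) := by
  simp [dz, dzbar, fderiv_cplx h, map_ofNat]

theorem fderiv_rpow_comp {n : ℕ} {ρ : (Fin n → ℂ) → ℝ} {z : Fin n → ℂ}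
    (h : DifferentiableAt ℝ ρ z) (hz : 0 < ρ z) (η : ℝ) (v : Fin n → ℂ) :
    fderiv ℝ (fun w => ρ w ^ η) z v = η * ρ z ^ (η - 1) * fderiv ℝ ρ z v := by
  rw [(h.hasFDerivAt.rpow_const (p := η) (Or.inl hz.ne')).fderiv]
  simp

theorem dz_cplx_rpow {n : ℕ} {ρ : (Fin n → ℂ) → ℝ} {z : Fin n → ℂ}
    (h : DifferentiableAt ℝ ρ z) (hz : 0 < ρ z) (η : ℝ) (j : Fin n) :
    dz j (cplx fun w => ρ w ^ η) z = ((η * ρ z ^ (η - 1) : ℝ) : ℂ) * dz j (cplx ρ) z := by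
  have h' : DifferentiableAt ℝ (fun w => ρ w ^ η) z := h.rpow_const (Or.inl hz.ne')
  simp only [dz, fderiv_cplx h, fderiv_cplx h', fderiv_rpow_comp h hz]
  push_cast
  ring

theorem dzbar_cplx_rpow {n : ℕ} {ρ : (Fin n → ℂ) → ℝ} {z : Fin n → ℂ}
    (h : DifferentiableAt ℝ ρ z) (hz : 0 < ρ z) (η : ℝ) (j : Fin n) :
    dzbar j (cplx fun w => ρ w ^ η) z =
      ((η * ρ z ^ (η - 1) : ℝ) : ℂ) * dzbar j (cplx ρ) z := by
  have h' : DifferentiableAt ℝ (fun w => ρ w ^ η) z := h.rpow_const (Or.inl hz.ne')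
  simp only [dzbar, fderiv_cplx h, fderiv_cplx h', fderiv_rpow_comp h hz]
  push_cast
  ring

/-- Complex Hessian of a power of a positive function. -/
theorem dz_dzbar_rpow {n : ℕ} {ρ : (Fin n → ℂ) → ℝ} {z : Fin n → ℂ}
    (h : ContDiffAt ℝ (⊤ : ℕ∞) ρ z) (hz : 0 < ρ z) (η : ℝ) (j k : Fin n) :
    dz j (fun w => dzbar k (cplx fun w => ρ w ^ η) w) z =
      ((η * ρ z ^ (η - 1) : ℝ) : ℂ) * (dz j (fun w => dzbar k (cplx ρ) w) z +
        (((η - 1) / ρ z : ℝ) : ℂ) * (dz j (cplx ρ) z * dzbar k (cplx ρ) z)) := by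
  have hd : ∀ᶠ w in 𝓝 z, ContDiffAt ℝ (1 : ℕ∞) ρ w :=
    (h.of_le (m := (1 : ℕ∞)) (by exact_mod_cast le_top)).eventually (by simp)
  have hpos : ∀ᶠ w in 𝓝 z, 0 < ρ w := h.continuousAt.eventually (lt_mem_nhds hz)
  have hev : (fun w => dzbar k (cplx fun w => ρ w ^ η) w) =ᶠ[𝓝 z]
      fun w => (η : ℂ) * (cplx (fun w => ρ w ^ (η - 1)) w * dzbar k (cplx ρ) w) := by
    filter_upwards [hd, hpos] with w hw hw'
    rw [dzbar_cplx_rpow (hw.differentiableAt (by simp)) hw']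
    simp [cplx, mul_assoc]
  have hρ : DifferentiableAt ℝ ρ z := h.differentiableAt (by simp)
  have h1 : DifferentiableAt ℝ (cplx fun w => ρ w ^ (η - 1)) z :=
    Complex.ofRealCLM.differentiableAt.comp z (hρ.rpow_const (Or.inl hz.ne'))
  have h2 : DifferentiableAt ℝ (fun w => dzbar k (cplx ρ) w) z :=
    (contDiffAt_dzbar (contDiffAt_cplx h) k).differentiableAt (by simp)
  rw [dz_congr hev, dz_mul (differentiableAt_const _) (h1.fun_mul h2), dz_mul h1 h2,
    dz_cplx_rpow hρ hz]
  have hc : dz j (fun _ : Fin n → ℂ => (η : ℂ)) z = 0 := by simp [dz]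
  have hp : ρ z ^ (η - 1 - 1) = ρ z ^ (η - 1) / ρ z := by
    rw [Real.rpow_sub hz, Real.rpow_one]
  rw [hc, hp]
  simp only [cplx]
  push_cast
  ring

theorem sum_dzbar_mul_conj {n : ℕ} {ρ : (Fin n → ℂ) → ℝ} {z : Fin n → ℂ}
    (h : DifferentiableAt ℝ ρ z) (X : Fin n → ℂ) :
    ∑ k, dzbar k (cplx ρ) z * (starRingEnd ℂ) (X k) =
      (starRingEnd ℂ) (dirDeriv X (cplx ρ) z) := by
  simp only [dirDeriv, map_sum, map_mul, dzbar_cplx h, mul_comm]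

/-- Levi form of a power of a positive function. -/
theorem levi_rpow {n : ℕ} {ρ : (Fin n → ℂ) → ℝ} {z : Fin n → ℂ}
    (h : ContDiffAt ℝ (⊤ : ℕ∞) ρ z) (hz : 0 < ρ z) (η : ℝ) (X : Fin n → ℂ) :
    levi (fun w => ρ w ^ η) X X z = ((η * ρ z ^ (η - 1) : ℝ) : ℂ) *
      (levi ρ X X z + (((η - 1) / ρ z * Complex.normSq (dirDeriv X (cplx ρ) z) : ℝ) : ℂ)) := by
  have hρ : DifferentiableAt ℝ ρ z := h.differentiableAt (by simp)
  have hN : ((Complex.normSq (dirDeriv X (cplx ρ) z) : ℝ) : ℂ) =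
      ∑ j, ∑ k, (dz j (cplx ρ) z * dzbar k (cplx ρ) z) * X j * (starRingEnd ℂ) (X k) := by
    rw [← Complex.mul_conj, ← sum_dzbar_mul_conj hρ, dirDeriv, Finset.sum_mul_sum]
    exact Finset.sum_congr rfl fun j _ => Finset.sum_congr rfl fun k _ => by ring
  rw [Complex.ofReal_mul ((η - 1) / ρ z), hN]
  simp only [levi, dz_dzbar_rpow h hz, Finset.mul_sum, ← Finset.sum_add_distrib]
  exact Finset.sum_congr rfl fun j _ => Finset.sum_congr rfl fun k _ => by ring

/-- The complex Hessian in terms of the real one. -/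
theorem dz_dzbar_eq {n : ℕ} {ρ : (Fin n → ℂ) → ℝ} {z : Fin n → ℂ}
    (h : ContDiffAt ℝ (⊤ : ℕ∞) ρ z) (j k : Fin n) :
    dz j (fun w => dzbar k (cplx ρ) w) z =
      (((fderiv ℝ (fderiv ℝ ρ) z (Pi.single j 1) (Pi.single k 1) : ℝ) : ℂ) +
        Complex.I * (fderiv ℝ (fderiv ℝ ρ) z (Pi.single j 1) (Pi.single k Complex.I) : ℝ) -
        Complex.I * ((fderiv ℝ (fderiv ℝ ρ) z (Pi.single j Complex.I) (Pi.single k 1) : ℝ) +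
        Complex.I *
          (fderiv ℝ (fderiv ℝ ρ) z (Pi.single j Complex.I) (Pi.single k Complex.I) : ℝ))) / 4 := by
  have hd : ∀ᶠ w in 𝓝 z, ContDiffAt ℝ (1 : ℕ∞) ρ w :=
    (h.of_le (m := (1 : ℕ∞)) (by exact_mod_cast le_top)).eventually (by simp)
  have hB : HasFDerivAt (fderiv ℝ ρ) (fderiv ℝ (fderiv ℝ ρ) z) z :=
    ((h.fderiv_right (m := (⊤ : ℕ∞)) (by simp)).differentiableAt (by simp)).hasFDerivAt
  have hD : ∀ v : Fin n → ℂ, HasFDerivAt (fun w => ((fderiv ℝ ρ w v : ℝ) : ℂ))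
      (Complex.ofRealCLM.comp ((ContinuousLinearMap.apply ℝ ℝ v).comp
        (fderiv ℝ (fderiv ℝ ρ) z))) z := fun v =>
    Complex.ofRealCLM.hasFDerivAt.comp z
      ((ContinuousLinearMap.apply ℝ ℝ v).hasFDerivAt.comp z hB)
  have hev : (fun w => dzbar k (cplx ρ) w) =ᶠ[𝓝 z] fun w =>
      (2⁻¹ : ℂ) * (((fderiv ℝ ρ w (Pi.single k 1) : ℝ) : ℂ) +
        Complex.I * ((fderiv ℝ ρ w (Pi.single k Complex.I) : ℝ) : ℂ)) := by
    filter_upwards [hd] with w hw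
    simp only [dzbar, fderiv_cplx (hw.differentiableAt (by simp))]
    ring
  have hF := (((hD (Pi.single k 1)).add ((hD (Pi.single k Complex.I)).const_mul Complex.I)).const_mul
    (2⁻¹ : ℂ)).fderiv
  rw [dz_congr hev, dz]
  erw [hF]
  simp
  ring

theorem dz_dzbar_conj {n : ℕ} {ρ : (Fin n → ℂ) → ℝ} {z : Fin n → ℂ}
    (h : ContDiffAt ℝ (⊤ : ℕ∞) ρ z) (j k : Fin n) :
    (starRingEnd ℂ) (dz j (fun w => dzbar k (cplx ρ) w) z) =
      dz k (fun w => dzbar j (cplx ρ) w) z := by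
  have hs : IsSymmSndFDerivAt ℝ ρ z := h.isSymmSndFDerivAt (by
    rw [minSmoothness_of_isRCLikeNormedField]
    exact WithTop.coe_le_coe.mpr (le_top : (2 : ℕ∞) ≤ ⊤))
  rw [dz_dzbar_eq h, dz_dzbar_eq h, hs.eq (Pi.single j 1) (Pi.single k 1),
    hs.eq (Pi.single j 1) (Pi.single k Complex.I), hs.eq (Pi.single j Complex.I) (Pi.single k 1),
    hs.eq (Pi.single j Complex.I) (Pi.single k Complex.I)]
  simp [map_ofNat]
  ring

theorem levi_conj {n : ℕ} {ρ : (Fin n → ℂ) → ℝ} {z : Fin n → ℂ}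
    (h : ContDiffAt ℝ (⊤ : ℕ∞) ρ z) (X Y : Fin n → ℂ) :
    (starRingEnd ℂ) (levi ρ X Y z) = levi ρ Y X z := by
  simp only [levi, map_sum, map_mul, dz_dzbar_conj h, Complex.conj_conj]
  rw [Finset.sum_comm]
  exact Finset.sum_congr rfl fun j _ => Finset.sum_congr rfl fun k _ => by ring

theorem levi_self_im {n : ℕ} {ρ : (Fin n → ℂ) → ℝ} {z : Fin n → ℂ}
    (h : ContDiffAt ℝ (⊤ : ℕ∞) ρ z) (X : Fin n → ℂ) : (levi ρ X X z).im = 0 :=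
  Complex.conj_eq_iff_im.mp (levi_conj h X X)

theorem levi_smul_add_smul {n : ℕ} (ρ : (Fin n → ℂ) → ℝ) (z X Y : Fin n → ℂ) (a b : ℂ) :
    levi ρ (a • X + b • Y) (a • X + b • Y) z =
      a * (starRingEnd ℂ) a * levi ρ X X z + a * (starRingEnd ℂ) b * levi ρ X Y z +
      (b * (starRingEnd ℂ) a * levi ρ Y X z + b * (starRingEnd ℂ) b * levi ρ Y Y z) := by
  simp only [levi, Finset.mul_sum, ← Finset.sum_add_distrib]
  refine Finset.sum_congr rfl fun j _ => Finset.sum_congr rfl fun k _ => ?_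
  simp only [Pi.add_apply, Pi.smul_apply, smul_eq_mul, map_add, map_mul]
  ring

theorem levi_smul_add_smul_re {n : ℕ} {ρ : (Fin n → ℂ) → ℝ} {z : Fin n → ℂ}
    (h : ContDiffAt ℝ (⊤ : ℕ∞) ρ z) (X Y : Fin n → ℂ) (a b : ℂ) :
    (levi ρ (a • X + b • Y) (a • X + b • Y) z).re =
      Complex.normSq a * (levi ρ X X z).re +
      2 * (a * (starRingEnd ℂ) b * levi ρ X Y z).re +
      Complex.normSq b * (levi ρ Y Y z).re := by
  rw [levi_smul_add_smul, ← levi_conj h X Y, Complex.mul_conj, Complex.mul_conj]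
  simp
  ring

theorem dirDeriv_smul_add_smul {n : ℕ} (f : (Fin n → ℂ) → ℂ) (z X Y : Fin n → ℂ) (a b : ℂ) :
    dirDeriv (a • X + b • Y) f z = a * dirDeriv X f z + b * dirDeriv Y f z := by
  simp only [dirDeriv, Finset.mul_sum, ← Finset.sum_add_distrib]
  refine Finset.sum_congr rfl fun j _ => ?_
  simp only [Pi.add_apply, Pi.smul_apply, smul_eq_mul]
  ring

theorem realLinear_eq_sum {n : ℕ} (l : (Fin n → ℂ) →L[ℝ] ℝ) (X : Fin n → ℂ) :
    l X = ∑ j, ((X j).re * l (Pi.single j 1) + (X j).im * l (Pi.single j Complex.I)) := by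
  conv_lhs => rw [← Finset.univ_sum_single X]
  rw [map_sum]
  refine Finset.sum_congr rfl fun j _ => ?_
  have : (Pi.single j (X j) : Fin n → ℂ) =
      (X j).re • (Pi.single j 1 : Fin n → ℂ) +
        (X j).im • (Pi.single j Complex.I : Fin n → ℂ) := by
    rw [← Pi.single_smul, ← Pi.single_smul, ← Pi.single_add]
    congr 1
    simp [Complex.re_add_im]
  rw [this, map_add, map_smul, map_smul, smul_eq_mul, smul_eq_mul]

theorem dirDeriv_cplx_re {n : ℕ} {g : (Fin n → ℂ) → ℝ} {z : Fin n → ℂ}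
    (h : DifferentiableAt ℝ g z) (X : Fin n → ℂ) :
    (dirDeriv X (cplx g) z).re = fderiv ℝ g z X / 2 := by
  rw [realLinear_eq_sum (fderiv ℝ g z) X, dirDeriv, Complex.re_sum, Finset.sum_div]
  refine Finset.sum_congr rfl fun j _ => ?_
  simp only [dz, fderiv_cplx h]
  simp
  ring

theorem gradNorm_eq {n : ℕ} {ρ : (Fin n → ℂ) → ℝ} {z : Fin n → ℂ}
    (h : DifferentiableAt ℝ ρ z) :
    gradNorm ρ z = 2 * Real.sqrt (∑ k, Complex.normSq (dz k (cplx ρ) z)) := by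
  have : ∑ j, ((fderiv ℝ ρ z (Pi.single j 1)) ^ 2 + (fderiv ℝ ρ z (Pi.single j Complex.I)) ^ 2) =
      2 ^ 2 * ∑ k, Complex.normSq (dz k (cplx ρ) z) := by
    rw [Finset.mul_sum]
    refine Finset.sum_congr rfl fun j _ => ?_
    simp only [dz, fderiv_cplx h, Complex.normSq_apply]
    simp
    ring
  rw [gradNorm, this, Real.sqrt_mul (by positivity), Real.sqrt_sq (by norm_num)]

theorem dirDeriv_nfield {n : ℕ} {ρ : (Fin n → ℂ) → ℝ} {z : Fin n → ℂ}
    (h : DifferentiableAt ℝ ρ z) :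
    dirDeriv (nfield ρ z) (cplx ρ) z =
      ((Real.sqrt (∑ k, Complex.normSq (dz k (cplx ρ) z)) : ℝ) : ℂ) := by
  set S := ∑ k, Complex.normSq (dz k (cplx ρ) z) with hS
  have hS0 : 0 ≤ S := Finset.sum_nonneg fun k _ => Complex.normSq_nonneg _
  have : dirDeriv (nfield ρ z) (cplx ρ) z = ((Real.sqrt S : ℝ) : ℂ)⁻¹ * ((S : ℝ) : ℂ) := by
    rw [hS, Complex.ofReal_sum, Finset.mul_sum]
    refine Finset.sum_congr rfl fun j _ => ?_
    rw [nfield, dzbar_cplx h, ← Complex.mul_conj]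
    ring
  rw [this, ← Complex.ofReal_inv, ← Complex.ofReal_mul]
  congr 1
  rw [inv_mul_eq_div, Real.div_sqrt]

theorem sum_normSq_dz_pos {n : ℕ} {ρ : (Fin n → ℂ) → ℝ} {z : Fin n → ℂ}
    (h : DifferentiableAt ℝ ρ z) (hne : fderiv ℝ ρ z ≠ 0) :
    0 < ∑ k, Complex.normSq (dz k (cplx ρ) z) := by
  refine lt_of_le_of_ne (Finset.sum_nonneg fun k _ => Complex.normSq_nonneg _) fun h0 => hne ?_
  have hk : ∀ k, dz k (cplx ρ) z = 0 := fun k => Complex.normSq_eq_zero.mp <|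
    (Finset.sum_eq_zero_iff_of_nonneg fun k _ => Complex.normSq_nonneg _).mp h0.symm k
      (Finset.mem_univ k)
  ext X
  have := dirDeriv_cplx_re h X
  simp only [dirDeriv, hk, mul_zero, Finset.sum_const_zero, Complex.zero_re] at this
  simp only [zero_apply]
  linarith

/-- A binary Hermitian form with positive leading entry and determinant is positive definite. -/
theorem hermitian_two_pos {A C : ℝ} {B : ℂ} (hA : 0 < A) (hdet : Complex.normSq B < A * C)
    {a b : ℂ} (hab : ¬(a = 0 ∧ b = 0)) :
    0 < Complex.normSq a * A + 2 * (a * (starRingEnd ℂ) b * B).re + Complex.normSq b * C := by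
  have key : A * (Complex.normSq a * A + 2 * (a * (starRingEnd ℂ) b * B).re +
      Complex.normSq b * C) =
      Complex.normSq (A * a + b * (starRingEnd ℂ) B) +
        Complex.normSq b * (A * C - Complex.normSq B) := by
    simp only [Complex.normSq_apply]
    simp
    ring
  refine pos_of_mul_pos_right (a := A) ?_ hA.le
  rw [key]
  by_cases hb : b = 0
  · have ha : a ≠ 0 := fun ha => hab ⟨ha, hb⟩
    have : 0 < Complex.normSq ((A : ℂ) * a) :=
      Complex.normSq_pos.mpr (mul_ne_zero (Complex.ofReal_ne_zero.mpr hA.ne') ha)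
    simpa [hb] using this
  · have := mul_pos (Complex.normSq_pos.mpr hb) (sub_pos.mpr hdet)
    linarith [Complex.normSq_nonneg (A * a + b * (starRingEnd ℂ) B)]

theorem Convex.sub_smul_mem_of_mem_Icc {E : Type*} [AddCommGroup E] [Module ℝ E] {K : Set E}
    (hK : Convex ℝ K) {z v : E} (hz : z ∈ K) {s : ℝ} (hs : 0 < s) (hzs : z - s • v ∈ K)
    {t : ℝ} (ht : t ∈ Set.Icc 0 s) : z - t • v ∈ K := by
  have := hK hz hzs (a := 1 - t / s) (b := t / s)
    (by rw [sub_nonneg, div_le_one hs]; exact ht.2) (div_nonneg ht.1 hs.le) (by ring)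
  convert this using 1
  rw [smul_sub, smul_smul, div_mul_cancel₀ _ hs.ne', sub_smul, one_smul]
  abel

/-- A function with positive derivative along `v` at a point is strictly increasing along `v`
near that point. -/
theorem exists_ball_lt_add_smul {E : Type*} [NormedAddCommGroup E] [NormedSpace ℝ E]
    {f : E → ℝ} {p v : E} (hf : ContDiffAt ℝ 1 f p) (hv : 0 < fderiv ℝ f p v) :
    ∃ r > 0, (∀ z ∈ Metric.ball p r, ContinuousAt f z) ∧
      ∀ z ∈ Metric.ball p r, ∀ s > (0 : ℝ), z - s • v ∈ Metric.ball p r →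
        f (z - s • v) < f z := by
  have hd : ∀ᶠ w in 𝓝 p, ContDiffAt ℝ 1 f w := hf.eventually (by simp)
  have hc : ContinuousAt (fun w => fderiv ℝ f w v) p :=
    (hf.fderiv_right (m := 0) (by simp)).continuousAt.clm_apply continuousAt_const
  obtain ⟨r, hr, hball⟩ := Metric.eventually_nhds_iff_ball.mp
    (hd.and (hc.eventually (lt_mem_nhds hv)))
  refine ⟨r, hr, fun z hz => (hball z hz).1.continuousAt, fun z hz s hs hzs => ?_⟩
  have hseg : ∀ t ∈ Set.Icc (0 : ℝ) s, z - t • v ∈ Metric.ball p r := fun t ht =>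
    (convex_ball p r).sub_smul_mem_of_mem_Icc hz hs hzs ht
  have hder : ∀ t ∈ Set.Icc (0 : ℝ) s,
      HasDerivAt (fun t : ℝ => f (z - t • v)) (fderiv ℝ f (z - t • v) (-((1 : ℝ) • v))) t := by
    intro t ht
    exact ((hball _ (hseg t ht)).1.differentiableAt (by simp)).hasFDerivAt.comp_hasDerivAt t
      (((hasDerivAt_id t).smul_const v).const_sub z)
  have := strictAntiOn_of_deriv_neg (convex_Icc 0 s)
    (fun t ht => (hder t ht).continuousAt.continuousWithinAt) (fun t ht => by
      rw [interior_Icc] at ht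
      have ht' := Set.Ioo_subset_Icc_self ht
      rw [(hder t ht').deriv, one_smul, map_neg, neg_lt_zero]
      exact (hball _ (hseg t ht')).2)
  simpa using this (Set.left_mem_Icc.mpr hs.le) (Set.right_mem_Icc.mpr hs.le) hs

/-- Zeros of `ρ` near a noncritical point are limits of points where `ρ` is negative. -/
theorem eventually_mem_closure_neg {E : Type*} [NormedAddCommGroup E] [NormedSpace ℝ E]
    {ρ : E → ℝ} {p v : E} (hρ : ContDiffAt ℝ 1 ρ p) (hv : 0 < fderiv ℝ ρ p v)
    {W : Set E} (hW : IsOpen W) (hp : p ∈ W) :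
    ∀ᶠ z in 𝓝 p, ρ z = 0 → z ∈ closure {w ∈ W | ρ w < 0} := by
  obtain ⟨r, hr, -, hmono⟩ := exists_ball_lt_add_smul hρ hv
  filter_upwards [Metric.ball_mem_nhds p hr, hW.mem_nhds hp] with z hz hzW h0
  have hlim : Filter.Tendsto (fun s : ℝ => z - s • v) (𝓝[>] 0) (𝓝 z) := by
    have : ContinuousAt (fun s : ℝ => z - s • v) 0 := by fun_prop
    simpa [ContinuousAt] using this.mono_left nhdsWithin_le_nhds
  refine mem_closure_of_tendsto hlim ?_
  filter_upwards [hlim (Metric.isOpen_ball.mem_nhds hz), hlim (hW.mem_nhds hzW),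
    self_mem_nhdsWithin] with s h1 h2 h3
  exact ⟨h2, h0 ▸ hmono z hz s h3 h1⟩

/-- If `h ≥ 0` on the zero set of `ρ` and both functions increase along `v`, then `h ≥ 0`
on the positive side of `ρ`. -/
theorem eventually_nonneg_of_nonneg_on_zero {E : Type*} [NormedAddCommGroup E] [NormedSpace ℝ E]
    {ρ h : E → ℝ} {p v : E} (hρ : ContDiffAt ℝ 1 ρ p) (hv : 0 < fderiv ℝ ρ p v)
    (hh : ContDiffAt ℝ 1 h p) (hhv : 0 < fderiv ℝ h p v) (hp : ρ p = 0)
    (hz : ∀ᶠ q in 𝓝 p, ρ q = 0 → 0 ≤ h q) :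
    ∀ᶠ z in 𝓝 p, 0 < ρ z → 0 ≤ h z := by
  obtain ⟨r₁, hr₁, hcont, hmono⟩ := exists_ball_lt_add_smul hρ hv
  obtain ⟨r₂, hr₂, -, hmono₂⟩ := exists_ball_lt_add_smul hh hhv
  obtain ⟨r₃, hr₃, hz₃⟩ := Metric.eventually_nhds_iff_ball.mp hz
  set r := min r₁ (min r₂ r₃) with hrdef
  have hr : 0 < r := by positivity
  have hlim : Filter.Tendsto (fun s : ℝ => p - s • v) (𝓝[>] 0) (𝓝 p) := by
    have : ContinuousAt (fun s : ℝ => p - s • v) 0 := by fun_prop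
    simpa [ContinuousAt] using this.mono_left nhdsWithin_le_nhds
  obtain ⟨s, hsb, hs⟩ :=
    ((hlim.eventually (Metric.ball_mem_nhds p hr)).and self_mem_nhdsWithin).exists
  replace hs : 0 < s := hs
  replace hsb : p - s • v ∈ Metric.ball p r := hsb
  have hb₁ : Metric.ball p r ⊆ Metric.ball p r₁ := Metric.ball_subset_ball (min_le_left _ _)
  have hb₂ : Metric.ball p r ⊆ Metric.ball p r₂ :=
    Metric.ball_subset_ball ((min_le_right _ _).trans (min_le_left _ _))
  have hb₃ : Metric.ball p r ⊆ Metric.ball p r₃ :=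
    Metric.ball_subset_ball ((min_le_right _ _).trans (min_le_right _ _))
  have hneg : ρ (p - s • v) < 0 :=
    hp ▸ hmono p (Metric.mem_ball_self hr₁) s hs (hb₁ hsb)
  have hshift : Filter.Tendsto (fun z => z - s • v) (𝓝 p) (𝓝 (p - s • v)) := by
    have : ContinuousAt (fun z : E => z - s • v) p := by fun_prop
    exact this
  filter_upwards [Metric.ball_mem_nhds p hr, hshift (Metric.isOpen_ball.mem_nhds hsb),
    hshift ((hcont _ (hb₁ hsb)).eventually (gt_mem_nhds hneg))] with z hzb hzs hzneg hzpos
  replace hzneg : ρ (z - s • v) < 0 := hzneg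
  have hseg : ∀ t ∈ Set.Icc (0 : ℝ) s, z - t • v ∈ Metric.ball p r := fun t ht =>
    (convex_ball p r).sub_smul_mem_of_mem_Icc hzb hs hzs ht
  have hcon : ContinuousOn (fun t : ℝ => ρ (z - t • v)) (Set.Icc 0 s) := fun t ht =>
    (ContinuousAt.comp (f := fun t : ℝ => z - t • v) (hcont _ (hb₁ (hseg t ht)))
      (by fun_prop)).continuousWithinAt
  obtain ⟨t, ht, ht0⟩ := intermediate_value_Icc' hs.le hcon
    (show (0 : ℝ) ∈ Set.Icc _ _ from ⟨hzneg.le, by simpa using hzpos.le⟩)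
  replace ht0 : ρ (z - t • v) = 0 := ht0
  have htpos : 0 < t := lt_of_le_of_ne ht.1 fun h0 => by
    rw [← h0, zero_smul, sub_zero] at ht0
    exact hzpos.ne' ht0
  exact (hz₃ _ (hb₃ (hseg t ht)) ht0).trans
    (hmono₂ z (hb₂ hzb) t htpos (hb₂ (hseg t ht))).le

theorem contDiffAt_levi_apply {n : ℕ} {ρ : (Fin n → ℂ) → ℝ} {L : (Fin n → ℂ) → (Fin n → ℂ)}
    {p : Fin n → ℂ} (h : ContDiffAt ℝ (⊤ : ℕ∞) ρ p) (hL : ContDiffAt ℝ (⊤ : ℕ∞) L p) :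
    ContDiffAt ℝ (⊤ : ℕ∞) (fun w => levi ρ (L w) (L w) w) p := by
  have hLj : ∀ j, ContDiffAt ℝ (⊤ : ℕ∞) (fun w => L w j) p := contDiffAt_pi.mp hL
  refine ContDiffAt.sum fun j _ => ContDiffAt.sum fun k _ => ?_
  exact ((contDiffAt_dz (contDiffAt_dzbar (contDiffAt_cplx h) k) j).mul (hLj j)).mul
    (Complex.conjCLE.contDiff.contDiffAt.comp p (hLj k))

theorem continuousAt_levi_apply {n : ℕ} {ρ : (Fin n → ℂ) → ℝ}
    {X Y : (Fin n → ℂ) → (Fin n → ℂ)} {p : Fin n → ℂ} (h : ContDiffAt ℝ (⊤ : ℕ∞) ρ p)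
    (hX : ContinuousAt X p) (hY : ContinuousAt Y p) :
    ContinuousAt (fun w => levi ρ (X w) (Y w) w) p := by
  refine tendsto_finsetSum _ fun j _ => tendsto_finsetSum _ fun k _ => ?_
  exact ((contDiffAt_dz (contDiffAt_dzbar (contDiffAt_cplx h) k) j).continuousAt.mul
    (continuousAt_pi.mp hX j)).mul
    (Complex.continuous_conj.continuousAt.comp (continuousAt_pi.mp hY k))

theorem continuousAt_sum_normSq_dz {n : ℕ} {ρ : (Fin n → ℂ) → ℝ} {p : Fin n → ℂ}
    (h : ContDiffAt ℝ (⊤ : ℕ∞) ρ p) :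
    ContinuousAt (fun w => ∑ k, Complex.normSq (dz k (cplx ρ) w)) p :=
  tendsto_finsetSum _ fun k _ => Complex.continuous_normSq.continuousAt.comp
    (contDiffAt_dz (contDiffAt_cplx h) k).continuousAt

theorem continuousAt_nfield {n : ℕ} {ρ : (Fin n → ℂ) → ℝ} {p : Fin n → ℂ}
    (h : ContDiffAt ℝ (⊤ : ℕ∞) ρ p) (hne : fderiv ℝ ρ p ≠ 0) :
    ContinuousAt (nfield ρ) p := by
  refine continuousAt_pi.mpr fun j => ?_
  refine ContinuousAt.mul (ContinuousAt.inv₀ ?_ ?_)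
    (contDiffAt_dzbar (contDiffAt_cplx h) j).continuousAt
  · exact Complex.continuous_ofReal.continuousAt.comp
      (Real.continuous_sqrt.continuousAt.comp (continuousAt_sum_normSq_dz h))
  · exact Complex.ofReal_ne_zero.mpr
      (Real.sqrt_pos.mpr (sum_normSq_dz_pos (h.differentiableAt (by simp)) hne)).ne'

/-- Positivity of the Levi form of `ρ ^ η` on the span of `X` and `N`, where `X` is tangential. -/
theorem levi_rpow_pos {n : ℕ} {ρ : (Fin n → ℂ) → ℝ} {z : Fin n → ℂ}
    (h : ContDiffAt ℝ (⊤ : ℕ∞) ρ z) (hz : 0 < ρ z) {η c : ℝ} (hη : 1 < η) (hc : 0 < c)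
    {X : Fin n → ℂ} (hX : dirDeriv X (cplx ρ) z = 0) (hXX : c * ρ z ≤ (levi ρ X X z).re)
    (hdet : Complex.normSq (levi ρ X (nfield ρ z) z) <
      c * (ρ z * (levi ρ (nfield ρ z) (nfield ρ z) z).re +
        (η - 1) * ∑ k, Complex.normSq (dz k (cplx ρ) z)))
    {a b : ℂ} (hab : ¬(a = 0 ∧ b = 0)) :
    0 < (levi (fun w => ρ w ^ η) (a • X + b • nfield ρ z) (a • X + b • nfield ρ z) z).re := by
  have hS0 : 0 ≤ ∑ k, Complex.normSq (dz k (cplx ρ) z) :=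
    Finset.sum_nonneg fun k _ => Complex.normSq_nonneg _
  rw [levi_rpow h hz, Complex.re_ofReal_mul, Complex.add_re, Complex.ofReal_re,
    dirDeriv_smul_add_smul, hX, dirDeriv_nfield (h.differentiableAt (by simp)),
    levi_smul_add_smul_re h, mul_zero, zero_add, Complex.normSq_mul, Complex.normSq_ofReal,
    Real.mul_self_sqrt hS0]
  set S := ∑ k, Complex.normSq (dz k (cplx ρ) z)
  set D := (levi ρ (nfield ρ z) (nfield ρ z) z).re
  have hA : 0 < (levi ρ X X z).re := (mul_pos hc hz).trans_le hXX
  have hC : ρ z * (D + (η - 1) / ρ z * S) = ρ z * D + (η - 1) * S := by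
    field_simp
  have hC0 : 0 < D + (η - 1) / ρ z * S := by
    refine pos_of_mul_pos_right (a := ρ z) ?_ hz.le
    rw [hC]
    exact pos_of_mul_pos_right (a := c) ((Complex.normSq_nonneg _).trans_lt hdet) hc.le
  have hdet' : Complex.normSq (levi ρ X (nfield ρ z) z) <
      (levi ρ X X z).re * (D + (η - 1) / ρ z * S) := by
    refine hdet.trans_le ?_
    rw [← hC, ← mul_assoc]
    exact mul_le_mul_of_nonneg_right hXX hC0.le
  have := hermitian_two_pos hA hdet' hab
  have hpow : 0 < η * ρ z ^ (η - 1) := mul_pos (by linarith) (Real.rpow_pos_of_pos hz _)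
  refine mul_pos hpow ?_
  linarith

/-- Lemma 3.3: if the strict key differential inequality holds on `Σ_L^α`,
then `L_{ρ^{η₂}}(aL+bN, aL+bN) > 0` outside `cl Ω` in a neighborhood of `Σ_L^α`. -/
theorem lemma_S2 {n : ℕ} (hn : 2 ≤ n) (Ω V U : Set (Fin n → ℂ)) (ρ : (Fin n → ℂ) → ℝ)
    (hΩ : IsOpen Ω) (hbd : Bornology.IsBounded Ω)
    (hdef : IsDefFn Ω V ρ) (hpsc : ∀ q ∈ frontier Ω, LeviPseudoconvexAt ρ q)
    (hU : IsOpen U) (hfr : frontier Ω ⊆ U)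
    (Uα : Set (Fin n → ℂ)) (hUα : IsOpen Uα) (hUαU : Uα ⊆ U)
    (L : (Fin n → ℂ) → (Fin n → ℂ)) (hL : IsTangentField ρ L Uα)
    (hnv : ∀ z ∈ Uα, L z ≠ 0) (hnorm : ∀ z ∈ Uα, enormSq (L z) = 1 / 2)
    (η₂ : ℝ) (hη : 1 < η₂)
    (hstrict : ∀ p ∈ frontier Ω ∩ Uα, levi ρ (L p) (L p) p = 0 →
      strictKeyIneqAt ρ L η₂ p) :
    ∃ VL : Set (Fin n → ℂ), IsOpen VL ∧ VL ⊆ Uα ∧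
      {p ∈ frontier Ω ∩ Uα | levi ρ (L p) (L p) p = 0} ⊆ VL ∧
      ∀ z ∈ (closure Ω)ᶜ ∩ VL, ∀ a b : ℂ, ¬(a = 0 ∧ b = 0) →
        0 < (levi (fun w => ρ w ^ η₂) (a • L z + b • nfield ρ z)
          (a • L z + b • nfield ρ z) z).re := by
  have hsm : ∀ z ∈ V, ContDiffAt ℝ (⊤ : ℕ∞) ρ z := fun z hz =>
    hdef.smooth.contDiffAt (hdef.isOpen.mem_nhds hz)
  refine ⟨interior {z | z ∈ Uα ∧ (z ∈ (closure Ω)ᶜ → ∀ a b : ℂ, ¬(a = 0 ∧ b = 0) →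
      0 < (levi (fun w => ρ w ^ η₂) (a • L z + b • nfield ρ z)
        (a • L z + b • nfield ρ z) z).re)}, isOpen_interior,
    fun z hz => (interior_subset hz).1, ?_, fun z hz => (interior_subset hz.2).2 hz.1⟩
  rintro p ⟨⟨hpf, hpU⟩, hp0⟩
  rw [mem_interior_iff_mem_nhds]
  have hpV : p ∈ V := hdef.subset hpf.1
  have hρ := hsm p hpV
  have hρd : DifferentiableAt ℝ ρ p := hρ.differentiableAt (by simp)
  have hρ1 : ContDiffAt ℝ 1 ρ p := hρ.of_le (by exact_mod_cast le_top)
  have hne := hdef.grad_ne p hpf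
  have hmem : ∀ z ∈ V, z ∈ Ω ↔ ρ z < 0 := fun z hz => by
    conv_lhs => rw [hdef.eq]
    exact ⟨fun h => h.2, fun h => ⟨hz, h⟩⟩
  have hρp : ρ p = 0 := by
    refine le_antisymm (le_of_not_gt fun hpos => ?_) (le_of_not_gt fun hneg => ?_)
    · obtain ⟨w, ⟨hw, hwV⟩, hwΩ⟩ := mem_closure_iff_nhds.mp hpf.1 _
        (Filter.inter_mem (hρ.continuousAt.eventually (lt_mem_nhds hpos))
          (hdef.isOpen.mem_nhds hpV))
      exact lt_asymm hw ((hmem w hwV).mp hwΩ)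
    · exact hpf.2 (hΩ.interior_eq.symm ▸ (hmem p hpV).mpr hneg)
  set S := fun w => ∑ k, Complex.normSq (dz k (cplx ρ) w) with hS
  have hSp : 0 < S p := sum_normSq_dz_pos hρd hne
  set v := nfield ρ p with hv
  have hρv : fderiv ℝ ρ p v = 2 * Real.sqrt (S p) := by
    have := dirDeriv_cplx_re hρd v
    rw [hv, dirDeriv_nfield hρd, Complex.ofReal_re] at this
    change Real.sqrt (S p) = _ at this
    linarith
  have hρv0 : 0 < fderiv ℝ ρ p v := by rw [hρv]; have := Real.sqrt_pos.mpr hSp; linarith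
  have hLp : ContDiffAt ℝ (⊤ : ℕ∞) L p := hL.1.contDiffAt (hUα.mem_nhds hpU)
  have hLL := contDiffAt_levi_apply hρ hLp
  set g : (Fin n → ℂ) → ℝ := fun w => (levi ρ (L w) (L w) w).re with hg
  have hgsm : ContDiffAt ℝ (⊤ : ℕ∞) g p := Complex.reCLM.contDiff.contDiffAt.comp p hLL
  have hg1 : ContDiffAt ℝ 1 g p := hgsm.of_le (by exact_mod_cast le_top)
  have hgd : DifferentiableAt ℝ g p := hgsm.differentiableAt (by simp)
  have hgv : (fieldDeriv (nfield ρ) (fun w => levi ρ (L w) (L w) w) p).re =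
      fderiv ℝ g p v / 2 := by
    rw [← dirDeriv_cplx_re hgd]
    have hev : (fun w => levi ρ (L w) (L w) w) =ᶠ[𝓝 p] cplx g := by
      filter_upwards [hdef.isOpen.mem_nhds hpV] with w hw
      exact Complex.ext rfl (by rw [levi_self_im (hsm w hw)]; rfl)
    simp only [fieldDeriv, dirDeriv, dz_congr hev]
    rfl
  have hkey := hstrict p ⟨hpf, hpU⟩ hp0
  rw [strictKeyIneqAt, hgv, gradNorm_eq hρd] at hkey
  change _ / (2 * Real.sqrt (S p)) ^ 2 - _ / (2 * Real.sqrt (S p)) < 0 at hkey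
  rw [mul_pow, Real.sq_sqrt hSp.le] at hkey
  set B := Complex.normSq (levi ρ (L p) v p) with hB
  have hB0 : 0 ≤ B := Complex.normSq_nonneg _
  have hη' : 0 < η₂ - 1 := by linarith
  obtain ⟨c, hc1, hc2⟩ : ∃ c, B / ((η₂ - 1) * S p) < c ∧
      c < fderiv ℝ g p v / (2 * Real.sqrt (S p)) := by
    refine exists_between ?_
    have e1 : 1 / (η₂ - 1) * B / (2 ^ 2 * S p) = B / ((η₂ - 1) * S p) / 4 := by
      field_simp; norm_num
    have e2 : 1 / 2 * (fderiv ℝ g p v / 2) / (2 * Real.sqrt (S p)) =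
      fderiv ℝ g p v / (2 * Real.sqrt (S p)) / 4 := by ring
    linarith
  have hc : 0 < c := lt_of_le_of_lt (by positivity) hc1
  rw [div_lt_iff₀ (by positivity)] at hc1
  rw [← hρv, lt_div_iff₀ hρv0] at hc2
  have hclos : ∀ᶠ z in 𝓝 p, ρ z = 0 → z ∈ closure Ω := by
    have := eventually_mem_closure_neg hρ1 hρv0 hdef.isOpen hpV
    rwa [← hdef.eq] at this
  have hge : ∀ᶠ z in 𝓝 p, 0 < ρ z → 0 ≤ g z - c * ρ z := by
    refine eventually_nonneg_of_nonneg_on_zero (h := fun z => g z - c * ρ z) hρ1 hρv0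
      (hg1.sub (contDiffAt_const.mul hρ1)) ?_ hρp ?_
    · rw [fderiv_fun_sub hgd (hρd.const_mul c), fderiv_const_mul hρd]
      simpa using hc2
    · filter_upwards [hclos, hdef.isOpen.mem_nhds hpV, hUα.mem_nhds hpU] with q h1 hqV hqU hq0
      have hqf : q ∈ frontier Ω := by
        refine ⟨h1 hq0, ?_⟩
        rw [hΩ.interior_eq, hmem q hqV, hq0]
        exact lt_irrefl 0
      simpa [hq0] using hpsc q hqf _ (hL.2 q hqU)
  have hdet : ∀ᶠ z in 𝓝 p, Complex.normSq (levi ρ (L z) (nfield ρ z) z) <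
      c * (ρ z * (levi ρ (nfield ρ z) (nfield ρ z) z).re + (η₂ - 1) * S z) := by
    have hN := continuousAt_nfield hρ hne
    refine ContinuousAt.eventually_lt
      (Complex.continuous_normSq.continuousAt.comp
        (continuousAt_levi_apply hρ hLp.continuousAt hN))
      (continuousAt_const.mul ((hρ.continuousAt.mul
        (Complex.continuous_re.continuousAt.comp (continuousAt_levi_apply hρ hN hN))).add
        (continuousAt_const.mul (continuousAt_sum_normSq_dz hρ)))) ?_
    change B < c * (ρ p * _ + (η₂ - 1) * S p)
    rw [hρp, zero_mul, zero_add]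
    exact hc1
  filter_upwards [hclos, hge, hdet, hdef.isOpen.mem_nhds hpV, hUα.mem_nhds hpU]
    with z h1 h2 h3 hzV hzU
  refine ⟨hzU, fun hz a b hab => ?_⟩
  have hzpos : 0 < ρ z := lt_of_le_of_ne
    (le_of_not_gt fun h => hz (subset_closure ((hmem z hzV).mpr h))) fun h => hz (h1 h.symm)
  exact levi_rpow_pos (hsm z hzV) hzpos hη hc (hL.2 z hzU) (sub_nonneg.mp (h2 hzpos)) h3 hab
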